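/- arXiv:2303.00492 — 5 statements merged into one kernel-verified Lean document; each statement's English description precedes it below -/
import Mathlib

section
/- Let a < b be real numbers, ε' > 0, and x ∈ [a,b]. Define the one-bit encoding probability p(x) = 1/(e^{ε'}+1) + ((x−a)/(b−a))·(e^{ε'}−1)/(e^{ε'}+1), and the recovered values y₁ = ((b−a)/2)·(e^{ε'}+1)/(e^{ε'}−1) + (a+b)/2 and y₀ = ((a−b)/2)·(e^{ε'}+1)/(e^{ε'}−1) + (a+b)/2. Then p(x)·y₁ + (1−p(x))·y₀ = x; that is, the recovered feature is an unbiased estimator of the original feature value x. -/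
/-- One-bit encoding probability. -/
noncomputable def oneBitProb (a b ε' x : ℝ) : ℝ :=
  1 / (Real.exp ε' + 1) + ((x - a) / (b - a)) * ((Real.exp ε' - 1) / (Real.exp ε' + 1))

/-- The recovered feature is an unbiased estimator of the original feature value. -/
theorem oneBit_recovery_unbiased (a b ε' x : ℝ) (hab : a < b) (hε : 0 < ε')
    (hx : x ∈ Set.Icc a b) :
    oneBitProb a b ε' x *
        (((b - a) / 2) * ((Real.exp ε' + 1) / (Real.exp ε' - 1)) + (a + b) / 2) +
      (1 - oneBitProb a b ε' x) *
        (((a - b) / 2) * ((Real.exp ε' + 1) / (Real.exp ε' - 1)) + (a + b) / 2) = x := by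
  have hba : b - a ≠ 0 := (sub_pos.mpr hab).ne'
  have hexp : Real.exp ε' - 1 ≠ 0 := (sub_pos.mpr (Real.one_lt_exp_iff.mpr hε)).ne'
  have hexp' : Real.exp ε' + 1 ≠ 0 := by positivity
  unfold oneBitProb
  field_simp
  ring
end

section
/- Let a < b be real numbers and ε' > 0. For all x, x' ∈ [a,b], the one-bit encoding probabilities satisfy p(x) ≤ e^{ε'}·p(x'), where p(x) = 1/(e^{ε'}+1) + ((x−a)/(b−a))·(e^{ε'}−1)/(e^{ε'}+1); that is, the probability of outputting the bit 1 changes by at most a multiplicative factor e^{ε'} between any two inputs. -/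
/-- The probability of outputting bit 1 changes by at most a multiplicative
factor `e^ε'` between any two inputs in `[a,b]`. -/
theorem oneBitProb_ldp_one (a b ε' : ℝ) (hab : a < b) (hε : 0 < ε') :
    ∀ x ∈ Set.Icc a b, ∀ x' ∈ Set.Icc a b,
      oneBitProb a b ε' x ≤ Real.exp ε' * oneBitProb a b ε' x' := by
  intro x hx x' hx'
  have hba : 0 < b - a := sub_pos.mpr hab
  have he : 1 < Real.exp ε' := Real.one_lt_exp_iff.mpr hε
  have hx_le : (x - a) / (b - a) ≤ 1 := (div_le_one hba).mpr (by linarith [hx.2])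
  have hx'_nonneg : 0 ≤ (x' - a) / (b - a) := div_nonneg (sub_nonneg.mpr hx'.1) hba.le
  unfold oneBitProb
  have hd : 0 < Real.exp ε' + 1 := by linarith
  have hc : 0 ≤ (Real.exp ε' - 1) / (Real.exp ε' + 1) := div_nonneg (by linarith) hd.le
  calc
    _ ≤ 1 / (Real.exp ε' + 1) + 1 * ((Real.exp ε' - 1) / (Real.exp ε' + 1)) := by gcongr
    _ = Real.exp ε' * (1 / (Real.exp ε' + 1)) := by field_simp; ring
    _ ≤ _ := by
      gcongr
      exact le_add_of_nonneg_right (mul_nonneg hx'_nonneg hc)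
end

section
/- Let a < b be real numbers and ε' > 0. For all x, x' ∈ [a,b], the one-bit encoding probabilities satisfy 1 − p(x) ≤ e^{ε'}·(1 − p(x')), where p(x) = 1/(e^{ε'}+1) + ((x−a)/(b−a))·(e^{ε'}−1)/(e^{ε'}+1); that is, the probability of outputting the bit 0 changes by at most a multiplicative factor e^{ε'} between any two inputs. -/
theorem one_sub_oneBitProb (a b ε' x : ℝ) :
    1 - oneBitProb a b ε' x =
      (Real.exp ε' - (x - a) / (b - a) * (Real.exp ε' - 1)) / (Real.exp ε' + 1) := by
  have : Real.exp ε' + 1 ≠ 0 := by positivity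
  rw [oneBitProb, eq_div_iff this, sub_mul, add_mul, mul_assoc, div_mul_cancel₀ _ this,
    div_mul_cancel₀ _ this]
  ring

/-- The probability of outputting bit 0 changes by at most a multiplicative
factor `e^ε'` between any two inputs in `[a,b]`. -/
theorem oneBitProb_ldp_zero (a b ε' : ℝ) (hab : a < b) (hε : 0 < ε') :
    ∀ x ∈ Set.Icc a b, ∀ x' ∈ Set.Icc a b,
      1 - oneBitProb a b ε' x ≤ Real.exp ε' * (1 - oneBitProb a b ε' x') := by
  rintro x ⟨hxa, -⟩ x' ⟨-, hxb'⟩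
  have hba : 0 < b - a := sub_pos.mpr hab
  have hE : 1 < Real.exp ε' := Real.one_lt_exp_iff.mpr hε
  have ht : 0 ≤ (x - a) / (b - a) := div_nonneg (sub_nonneg.mpr hxa) hba.le
  have ht' : (x' - a) / (b - a) ≤ 1 := (div_le_one hba).mpr (by linarith)
  rw [one_sub_oneBitProb, one_sub_oneBitProb, ← mul_div_assoc]
  gcongr
  have hnum : Real.exp ε' - (x - a) / (b - a) * (Real.exp ε' - 1) ≤ Real.exp ε' :=
    sub_le_self _ (mul_nonneg ht (by linarith))
  have hnum' : 1 ≤ Real.exp ε' - (x' - a) / (b - a) * (Real.exp ε' - 1) := by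
    linarith [mul_le_of_le_one_left (by linarith : 0 ≤ Real.exp ε' - 1) ht']
  exact hnum.trans (le_mul_of_one_le_right (Real.exp_pos ε').le hnum')
end

section
/- Let I be a finite index set, and for each i ∈ I let X_i be an input type, Y_i an output type, ε_i ≥ 0 a real number, and q_i : X_i × Y_i → ℝ≥0 a randomized mechanism kernel satisfying q_i(x, y) ≤ e^{ε_i}·q_i(x', y) for all x, x' ∈ X_i and y ∈ Y_i. Then the product mechanism satisfies, for all inputs x, x' ∈ Π_{i∈I} X_i and all outputs y ∈ Π_{i∈I} Y_i, the bound Π_{i∈I} q_i(x_i, y_i) ≤ e^{Σ_{i∈I} ε_i} · Π_{i∈I} q_i(x'_i, y_i); that is, independently composing mechanisms with ε_i-local differential privacy yields (Σ_i ε_i)-local differential privacy. -/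
open scoped NNReal

/-- Composability of local differential privacy: independently composing mechanisms
with `ε i`-LDP yields `(∑ i, ε i)`-LDP for the product mechanism. -/
theorem ldp_composition {I : Type*} [Fintype I]
    (X : I → Type*) (Y : I → Type*) (ε : I → ℝ) (hε : ∀ i, 0 ≤ ε i)
    (q : ∀ i, X i → Y i → ℝ≥0)
    (hq : ∀ i, ∀ x x' : X i, ∀ y : Y i,
      (q i x y : ℝ) ≤ Real.exp (ε i) * (q i x' y : ℝ)) :
    ∀ x x' : (∀ i, X i), ∀ y : (∀ i, Y i),
      (∏ i, (q i (x i) (y i) : ℝ)) ≤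
        Real.exp (∑ i, ε i) * ∏ i, (q i (x' i) (y i) : ℝ) := by
  intro x x' y
  rw [Real.exp_sum, ← Finset.prod_mul_distrib]
  exact Finset.prod_le_prod (fun i _ => (q i (x i) (y i)).coe_nonneg)
    (fun i _ => hq i (x i) (x' i) (y i))
end

section
/- Let c and n be positive natural numbers, let S be a finite set of states with |S| = 2^{c·n}, let f : S → ℝ, and let π be the Gibbs distribution on S given by π(x) = e^{f(x)} / Σ_{y∈S} e^{f(y)}, with f_opt = max_{y∈S} f(y). Then the probability under π of sampling a state x with f(x) ≤ f_opt − (c+1)·n·ln 2 is at most e^{−n·ln 2} = 2^{−n}; that is, the probability of sampling a solution whose objective value falls (c+1)·n·ln 2 below the optimum decreases exponentially in n·ln 2. -/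
open Finset

/-- Gibbs distribution on a nonempty finite type. -/
noncomputable def gibbs {S : Type*} [Fintype S] (f : S → ℝ) (x : S) : ℝ :=
  Real.exp (f x) / ∑ y, Real.exp (f y)

/-- Each state whose objective value is at least `t` below the maximum has Gibbs probability
at most `e^(-t)`. -/
theorem gibbs_le_exp_neg {S : Type*} [Fintype S] [Nonempty S] {f : S → ℝ} {t : ℝ} {x : S}
    (hx : f x ≤ univ.sup' univ_nonempty f - t) : gibbs f x ≤ Real.exp (-t) := by
  obtain ⟨m, -, hm⟩ := exists_mem_eq_sup' univ_nonempty f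
  have hle : Real.exp (f m) ≤ ∑ y, Real.exp (f y) :=
    single_le_sum (f := fun y => Real.exp (f y)) (fun y _ => (Real.exp_pos _).le) (mem_univ m)
  rw [gibbs, div_le_iff₀ ((Real.exp_pos _).trans_le hle)]
  calc Real.exp (f x) ≤ Real.exp (-t + f m) := Real.exp_le_exp.mpr (by linarith)
    _ = Real.exp (-t) * Real.exp (f m) := Real.exp_add _ _
    _ ≤ Real.exp (-t) * ∑ y, Real.exp (f y) :=
      mul_le_mul_of_nonneg_left hle (Real.exp_pos _).le

/-- On a state space of size `2^(c*n)`, the Gibbs probability of sampling a state whose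
objective value is at least `(c+1) * n * ln 2` below the optimum is at most
`e^(-(n * ln 2)) = 2^(-n)`. -/
theorem mcmc_solution_quality {S : Type*} [Fintype S] [Nonempty S]
    (c n : ℕ) (hc : 0 < c) (hn : 0 < n) (hcard : Fintype.card S = 2 ^ (c * n))
    (f : S → ℝ) :
    (∑ x ∈ univ.filter
        (fun x => f x ≤ univ.sup' univ_nonempty f - ((c : ℝ) + 1) * n * Real.log 2),
      gibbs f x) ≤ Real.exp (-((n : ℝ) * Real.log 2)) ∧
    Real.exp (-((n : ℝ) * Real.log 2)) = (2 : ℝ) ^ (-(n : ℝ)) := by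
  refine ⟨?_, by rw [Real.rpow_def_of_pos two_pos]; ring_nf⟩
  have hcard' : (Fintype.card S : ℝ) = Real.exp (c * n * Real.log 2) := by
    rw [hcard, ← Nat.cast_mul, Real.exp_nat_mul, Real.exp_log two_pos]
    norm_cast
  calc _ ≤ #(univ.filter fun x =>
          f x ≤ univ.sup' univ_nonempty f - ((c : ℝ) + 1) * n * Real.log 2) •
        Real.exp (-(((c : ℝ) + 1) * n * Real.log 2)) :=
        sum_le_card_nsmul _ _ _ fun x hx => gibbs_le_exp_neg (mem_filter.mp hx).2
    _ ≤ (Fintype.card S : ℝ) * Real.exp (-(((c : ℝ) + 1) * n * Real.log 2)) := by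
        rw [nsmul_eq_mul]
        gcongr
        exact card_le_univ _
    _ = Real.exp (-((n : ℝ) * Real.log 2)) := by
        rw [hcard', ← Real.exp_add]
        ring_nf
end
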